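/- Define on R^{16^q}, for 1 ≤ t ≤ q and α = 1,…,8, the matrices B^q(t,J_α) = diag_{16^t,16^{q−t}}( T_t · block_{16,16^{t−1}}(J_α) ), where T_t = ∏_{s=1}^{t−1} diag_{16^s,16^{t−s}}(C_s) (with T_1 = Id) and C_s = diag(Id_{16^s/2}, −Id_{16^s/2}). Then the 8q matrices B^q(t,J_α) are skew-symmetric, satisfy B^q(t,J_α)^2 = −Id, and pairwise anticommute; hence they give 8q orthonormal tangent vector fields at every point of S^{16^q −1}. -/

import Mathlib

/-- The Cayley–Dickson algebra `A^n` obtained from `ℝ` by `n` doublings. -/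
def CD : ℕ → Type
  | 0 => ℝ
  | n + 1 => CD n × CD n

namespace CD

def ofReal (r : ℝ) : CD 0 := r
def toReal (a : CD 0) : ℝ := a

noncomputable def add : {n : ℕ} → CD n → CD n → CD n
  | 0, a, b => ofReal (toReal a + toReal b)
  | _ + 1, a, b => (add a.1 b.1, add a.2 b.2)

noncomputable def neg : {n : ℕ} → CD n → CD n
  | 0, a => ofReal (-toReal a)
  | _ + 1, a => (neg a.1, neg a.2)

noncomputable def sub {n : ℕ} (a b : CD n) : CD n := add a (neg b)

/-- Cayley–Dickson conjugation: `(a,b)* = (a*, -b)`. -/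
noncomputable def conj : {n : ℕ} → CD n → CD n
  | 0, a => a
  | _ + 1, a => (conj a.1, neg a.2)

/-- Cayley–Dickson product: `(a,b)(c,d) = (ac - d*b, da + bc*)`. -/
noncomputable def mul : {n : ℕ} → CD n → CD n → CD n
  | 0, a, b => ofReal (toReal a * toReal b)
  | _ + 1, a, b =>
      (sub (mul a.1 b.1) (mul (conj b.2) a.2), add (mul b.2 a.1) (mul a.2 (conj b.1)))

noncomputable def zero : (n : ℕ) → CD n
  | 0 => ofReal 0
  | n + 1 => (zero n, zero n)

/-- The real part `Re(a) = (a + a*)/2`, read off as a real number. -/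
noncomputable def re : {n : ℕ} → CD n → ℝ
  | 0, a => toReal a
  | _ + 1, a => re a.1

/-- The standard Euclidean inner product under the identification `A^n = ℝ^(2^n)`. -/
noncomputable def inner : {n : ℕ} → CD n → CD n → ℝ
  | 0, a, b => toReal a * toReal b
  | _ + 1, a, b => inner a.1 b.1 + inner a.2 b.2

end CD

/-- The octonions, as the third Cayley–Dickson algebra. -/
noncomputable abbrev Oct : Type := CD 3

noncomputable def r2 (a b : ℝ) : CD 1 := (CD.ofReal a, CD.ofReal b)
noncomputable def r4 (a b c d : ℝ) : CD 2 := (r2 a b, r2 c d)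
noncomputable def r8 (a b c d e f g h : ℝ) : Oct := (r4 a b c d, r4 e f g h)

/-- The standard basis `1, i, j, k, e, f, g, h` of the octonions. -/
noncomputable def octBasis : Fin 8 → Oct :=
  ![r8 1 0 0 0 0 0 0 0, r8 0 1 0 0 0 0 0 0, r8 0 0 1 0 0 0 0 0, r8 0 0 0 1 0 0 0 0,
    r8 0 0 0 0 1 0 0 0, r8 0 0 0 0 0 1 0 0, r8 0 0 0 0 0 0 1 0, r8 0 0 0 0 0 0 0 1]
open Matrix

/-- Reindexing a square matrix along an equality of dimensions. -/
noncomputable def castM {a b : ℕ} (h : a = b) (M : Matrix (Fin a) (Fin a) ℝ) :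
    Matrix (Fin b) (Fin b) ℝ :=
  Matrix.reindex (finCongr h) (finCongr h) M

/-- `diagExt m n A = Id_n ⊗ A`: the block-diagonal matrix with `n` copies of
the `m × m` matrix `A` along the diagonal. -/
noncomputable def diagExt (m n : ℕ) (A : Matrix (Fin m) (Fin m) ℝ) :
    Matrix (Fin (m * n)) (Fin (m * n)) ℝ :=
  Matrix.of fun i j =>
    if hm : 0 < m then
      if i.val / m = j.val / m then
        A ⟨i.val % m, Nat.mod_lt _ hm⟩ ⟨j.val % m, Nat.mod_lt _ hm⟩
      else 0
    else 0

/-- `blockExt m n A = A ⊗ Id_n`: each entry `a` of the `m × m` matrix `A` is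
replaced by the `n × n` block `a • Id_n`. -/
noncomputable def blockExt (m n : ℕ) (A : Matrix (Fin m) (Fin m) ℝ) :
    Matrix (Fin (m * n)) (Fin (m * n)) ℝ :=
  Matrix.of fun i j =>
    if hn : 0 < n then
      if i.val % n = j.val % n then
        A ⟨i.val / n, (Nat.div_lt_iff_lt_mul hn).2 i.isLt⟩
          ⟨j.val / n, (Nat.div_lt_iff_lt_mul hn).2 j.isLt⟩
      else 0
    else 0

/-- The matrix (in the standard orthonormal basis of `𝕆 = ℝ^8`) of right
multiplication `R_u : x ↦ x·u` by the octonion `u`. -/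
noncomputable def Rmat (u : Oct) : Matrix (Fin 8) (Fin 8) ℝ :=
  Matrix.of fun r c => CD.inner (CD.mul (octBasis c) u) (octBasis r)

/-- The matrix (in the standard orthonormal basis of `𝕆 = ℝ^8`) of left
multiplication `L_u : x ↦ u·x` by the octonion `u`. -/
noncomputable def Lmat (u : Oct) : Matrix (Fin 8) (Fin 8) ℝ :=
  Matrix.of fun r c => CD.inner (CD.mul u (octBasis c)) (octBasis r)

noncomputable def toMat16 (M : Matrix (Fin 8 ⊕ Fin 8) (Fin 8 ⊕ Fin 8) ℝ) :
    Matrix (Fin 16) (Fin 16) ℝ :=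
  Matrix.reindex (finSumFinEquiv.trans (finCongr (show 8 + 8 = 16 by norm_num)))
    (finSumFinEquiv.trans (finCongr (show 8 + 8 = 16 by norm_num))) M

/-- The eight standard `Spin(9)` complex structures on `ℝ^16` (indexed `0,…,7`
for `J₁,…,J₈`): `J₁ = [[0,-Id₈],[Id₈,0]]` and `J_{α+1} = [[0,R_u],[R_u,0]]` for
the imaginary octonion units `u = i,j,k,e,f,g,h`. -/
noncomputable def J16 (α : Fin 8) : Matrix (Fin 16) (Fin 16) ℝ :=
  toMat16 <|
    if α = 0 then Matrix.fromBlocks 0 (-1) 1 0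
    else Matrix.fromBlocks 0 (Rmat (octBasis α)) (Rmat (octBasis α)) 0

/-- The diagonal involution `C_N` changing sign on the last half of the
coordinates of `ℝ^N`. -/
noncomputable def Cmat (N : ℕ) : Matrix (Fin N) (Fin N) ℝ :=
  Matrix.diagonal fun i => if 2 * i.val < N then 1 else -1

/-- `K_{q,t} = diag_{16^t,16^(q-t)}(C_t)`, the level-`t` conjugation on
`ℝ^(16^q)`. -/
noncomputable def Kmat (q t : ℕ) (h : t ≤ q) : Matrix (Fin (16 ^ q)) (Fin (16 ^ q)) ℝ :=
  castM (by rw [← pow_add, Nat.add_sub_cancel' h])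
    (diagExt (16 ^ t) (16 ^ (q - t)) (Cmat (16 ^ t)))

/-- `T_t = ∏_{s<t} diag_{16^s,16^(t-s)}(C_s)`: the product of the conjugations
of levels `1,…,t-1` (the `s = 0` factor is the identity). -/
noncomputable def Tmat (t : ℕ) : Matrix (Fin (16 ^ t)) (Fin (16 ^ t)) ℝ :=
  ((List.finRange t).map fun s => Kmat t s.val s.isLt.le).prod

/-- The vector field matrices
`B^q(t,J) = diag_{16^t,16^(q-t)}(T_t · block_{16,16^(t-1)}(J))` on `ℝ^(16^q)`. -/
noncomputable def Bq (q t : ℕ) (ht : 1 ≤ t) (htq : t ≤ q)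
    (J : Matrix (Fin 16) (Fin 16) ℝ) : Matrix (Fin (16 ^ q)) (Fin (16 ^ q)) ℝ :=
  castM (by rw [← pow_add, Nat.add_sub_cancel' htq])
    (diagExt (16 ^ t) (16 ^ (q - t))
      (Tmat t *
        castM (by rw [mul_comm 16 (16 ^ (t - 1)), ← pow_succ, Nat.sub_add_cancel ht])
          (blockExt 16 (16 ^ (t - 1)) J)))

open scoped Kronecker

/-! ### Right multiplication by octonions -/

/-- The octonion with prescribed coordinates in the standard basis. -/
noncomputable def octOfCoords (v : Fin 8 → ℝ) : Oct :=
  r8 (v 0) (v 1) (v 2) (v 3) (v 4) (v 5) (v 6) (v 7)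

theorem octBasis_eq_octOfCoords (α : Fin 8) : octBasis α = octOfCoords (Pi.single α 1) := by
  fin_cases α <;> simp [octBasis, octOfCoords]

/-- The matrix of right multiplication by the octonion with coordinates `v`. -/
def rightMulMatrix {R : Type*} [Ring R] (v : Fin 8 → R) : Matrix (Fin 8) (Fin 8) R :=
  !![v 0, -v 1, -v 2, -v 3, -v 4, -v 5, -v 6, -v 7;
     v 1, v 0, v 3, -v 2, v 5, -v 4, -v 7, v 6;
     v 2, -v 3, v 0, v 1, v 6, v 7, -v 4, -v 5;
     v 3, v 2, -v 1, v 0, v 7, -v 6, v 5, -v 4;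
     v 4, -v 5, -v 6, -v 7, v 0, v 1, v 2, v 3;
     v 5, v 4, -v 7, v 6, -v 1, v 0, -v 3, v 2;
     v 6, v 7, v 4, -v 5, -v 2, v 3, v 0, -v 1;
     v 7, -v 6, v 5, v 4, -v 3, -v 2, v 1, v 0]

set_option maxHeartbeats 1600000 in
theorem Rmat_octOfCoords (v : Fin 8 → ℝ) : Rmat (octOfCoords v) = rightMulMatrix v := by
  ext r c
  fin_cases r <;> fin_cases c <;>
    simp [Rmat, octBasis, octOfCoords, r8, r4, r2, CD.inner, CD.mul, CD.sub, CD.add, CD.neg,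
      CD.conj, CD.toReal, CD.ofReal, rightMulMatrix]

theorem rightMulMatrix_map {R S : Type*} [Ring R] [Ring S] (f : R →+* S) (v : Fin 8 → R) :
    (rightMulMatrix v).map f = rightMulMatrix (f ∘ v) := by
  ext r c
  fin_cases r <;> fin_cases c <;> first | rfl | exact map_neg f _

theorem Rmat_octBasis (α : Fin 8) :
    Rmat (octBasis α) = (Int.castRingHom ℝ).mapMatrix (rightMulMatrix (Pi.single α 1)) := by
  rw [octBasis_eq_octOfCoords, Rmat_octOfCoords, RingHom.mapMatrix_apply, rightMulMatrix_map]
  congr 1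
  ext i
  simp [Pi.single_apply]

theorem rightMulMatrix_single_transpose : ∀ α : Fin 8, α ≠ 0 →
    (rightMulMatrix (Pi.single α (1 : ℤ)))ᵀ = -rightMulMatrix (Pi.single α 1) := by
  decide +kernel

theorem rightMulMatrix_single_mul_add_mul : ∀ α β : Fin 8, α ≠ 0 → β ≠ 0 →
    rightMulMatrix (Pi.single α (1 : ℤ)) * rightMulMatrix (Pi.single β 1) +
      rightMulMatrix (Pi.single β 1) * rightMulMatrix (Pi.single α 1) =
      (if α = β then (-2 : ℤ) else 0) • 1 := by
  decide +kernel

theorem Rmat_octBasis_transpose {α : Fin 8} (hα : α ≠ 0) :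
    (Rmat (octBasis α))ᵀ = -Rmat (octBasis α) := by
  rw [Rmat_octBasis, ← map_neg, ← rightMulMatrix_single_transpose α hα]
  rfl

theorem Rmat_octBasis_mul_add_mul {α β : Fin 8} (hα : α ≠ 0) (hβ : β ≠ 0) :
    Rmat (octBasis α) * Rmat (octBasis β) + Rmat (octBasis β) * Rmat (octBasis α) =
      (if α = β then (-2 : ℝ) else 0) • 1 := by
  rw [Rmat_octBasis, Rmat_octBasis, ← map_mul, ← map_mul, ← map_add,
    rightMulMatrix_single_mul_add_mul α β hα hβ, map_zsmul, map_one, ← Int.cast_smul_eq_zsmul ℝ]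
  simp

/-! ### The complex structures on `ℝ^16` -/

theorem toMat16_mul (M N : Matrix (Fin 8 ⊕ Fin 8) (Fin 8 ⊕ Fin 8) ℝ) :
    toMat16 M * toMat16 N = toMat16 (M * N) := by
  simp [toMat16]

theorem toMat16_add (M N : Matrix (Fin 8 ⊕ Fin 8) (Fin 8 ⊕ Fin 8) ℝ) :
    toMat16 M + toMat16 N = toMat16 (M + N) := rfl

theorem J16_transpose (α : Fin 8) : (J16 α)ᵀ = -J16 α := by
  have key : ∀ M : Matrix (Fin 8 ⊕ Fin 8) (Fin 8 ⊕ Fin 8) ℝ, Mᵀ = -M →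
      (toMat16 M)ᵀ = -toMat16 M := fun M hM => by
    rw [toMat16, transpose_reindex, hM]; rfl
  unfold J16
  split_ifs with h
  · exact key _ (by simp [fromBlocks_transpose, fromBlocks_neg])
  · exact key _ (by simp [fromBlocks_transpose, fromBlocks_neg, Rmat_octBasis_transpose h])

theorem J16_mul_add_mul (α β : Fin 8) :
    J16 α * J16 β + J16 β * J16 α = (if α = β then (-2 : ℝ) else 0) • 1 := by
  have hscalar (c : ℝ) : toMat16 (fromBlocks (c • 1) 0 0 (c • 1)) = c • 1 := by
    have h : fromBlocks (c • 1) 0 0 (c • 1) =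
        c • (1 : Matrix (Fin 8 ⊕ Fin 8) (Fin 8 ⊕ Fin 8) ℝ) := by
      rw [← fromBlocks_one, fromBlocks_smul, smul_zero]
    rw [h, toMat16, reindex_apply, submatrix_smul, Pi.smul_apply, Pi.smul_apply,
      submatrix_one_equiv]
  rw [← hscalar]
  unfold J16
  rw [toMat16_mul, toMat16_mul, toMat16_add]
  by_cases hα : α = 0 <;> by_cases hβ : β = 0
  · simp [hα, hβ, fromBlocks_multiply, fromBlocks_add, neg_smul, two_smul]
  · simp [hα, hβ, fromBlocks_multiply, fromBlocks_add, Ne.symm hβ]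
  · simp [hα, hβ, fromBlocks_multiply, fromBlocks_add]
  · simp only [hα, hβ, if_false, fromBlocks_multiply, fromBlocks_add, zero_mul, mul_zero,
      add_zero, zero_add, Rmat_octBasis_mul_add_mul hα hβ]

theorem J16_mul_self (α : Fin 8) : J16 α * J16 α = -1 := by
  have h := J16_mul_add_mul α α
  rw [if_pos rfl, ← two_smul ℝ, neg_smul, ← smul_neg] at h
  exact smul_right_injective _ (two_ne_zero (α := ℝ)) h

theorem Cmat_sixteen : Cmat 16 = toMat16 (fromBlocks 1 0 0 (-1)) := by
  have h : fromBlocks (1 : Matrix (Fin 8) (Fin 8) ℝ) 0 0 (-1 : Matrix (Fin 8) (Fin 8) ℝ) =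
      diagonal (Sum.elim 1 (-1)) := by
    rw [← fromBlocks_diagonal, ← diagonal_one, diagonal_neg]; rfl
  rw [h, toMat16, reindex_apply, submatrix_diagonal_equiv, Cmat]
  congr 1
  ext i
  fin_cases i <;> rfl

theorem J16_mul_Cmat_add (α : Fin 8) : J16 α * Cmat 16 + Cmat 16 * J16 α = 0 := by
  rw [Cmat_sixteen]
  unfold J16
  rw [toMat16_mul, toMat16_mul, toMat16_add]
  split_ifs <;> simp [fromBlocks_multiply, fromBlocks_add] <;> rfl

/-! ### Extending matrices to larger powers of `16` -/

theorem castM_diagExt {m n N : ℕ} (h : m * n = N) (A : Matrix (Fin m) (Fin m) ℝ) :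
    castM h (diagExt m n A) =
      reindex (finProdFinEquiv.trans (finCongr ((mul_comm n m).trans h)))
        (finProdFinEquiv.trans (finCongr ((mul_comm n m).trans h))) (1 ⊗ₖ A) := by
  subst h
  ext i j
  have hm : 0 < m := Nat.pos_of_mul_pos_right i.pos
  simp [castM, diagExt, hm, Matrix.one_apply, Fin.ext_iff, finProdFinEquiv, Fin.divNat,
    Fin.modNat]

theorem castM_blockExt {m n N : ℕ} (h : m * n = N) (A : Matrix (Fin m) (Fin m) ℝ) :
    castM h (blockExt m n A) =
      reindex (finProdFinEquiv.trans (finCongr h)) (finProdFinEquiv.trans (finCongr h))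
        (A ⊗ₖ 1) := by
  subst h
  ext i j
  have hn : 0 < n := Nat.pos_of_mul_pos_left i.pos
  simp [castM, blockExt, hn, Matrix.one_apply, Fin.ext_iff, finProdFinEquiv, Fin.divNat,
    Fin.modNat]

/-- `liftPow t u h A` is the block-diagonal extension of `A` from `ℝ^(16^t)` to `ℝ^(16^u)`. -/
noncomputable def liftPow (t u : ℕ) (h : t ≤ u) (A : Matrix (Fin (16 ^ t)) (Fin (16 ^ t)) ℝ) :
    Matrix (Fin (16 ^ u)) (Fin (16 ^ u)) ℝ :=
  castM (by rw [← pow_add, Nat.add_sub_cancel' h]) (diagExt (16 ^ t) (16 ^ (u - t)) A)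

/-- The operator on `ℝ^(16^(t+1))` acting as `J` on the leading base-`16` digit. -/
noncomputable def topBlock (t : ℕ) (J : Matrix (Fin 16) (Fin 16) ℝ) :
    Matrix (Fin (16 ^ (t + 1))) (Fin (16 ^ (t + 1))) ℝ :=
  castM (pow_succ' 16 t).symm (blockExt 16 (16 ^ t) J)

section liftPow

variable {t u : ℕ} (h : t ≤ u) (A B : Matrix (Fin (16 ^ t)) (Fin (16 ^ t)) ℝ)

theorem liftPow_mul : liftPow t u h (A * B) = liftPow t u h A * liftPow t u h B := by
  simp only [liftPow, castM_diagExt, reindex_apply]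
  rw [submatrix_mul_equiv, ← mul_kronecker_mul, one_mul]

theorem liftPow_add : liftPow t u h (A + B) = liftPow t u h A + liftPow t u h B := by
  simp only [liftPow, castM_diagExt, kronecker_add]
  rfl

theorem liftPow_zero : liftPow t u h 0 = 0 := by
  simp [liftPow, castM_diagExt]

theorem liftPow_one : liftPow t u h 1 = 1 := by
  rw [liftPow, castM_diagExt, one_kronecker_one, reindex_apply, submatrix_one_equiv]

theorem liftPow_neg : liftPow t u h (-A) = -liftPow t u h A := by
  rw [eq_neg_iff_add_eq_zero, ← liftPow_add, neg_add_cancel, liftPow_zero]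

theorem liftPow_transpose : (liftPow t u h A)ᵀ = liftPow t u h Aᵀ := by
  simp only [liftPow, castM_diagExt, transpose_reindex, ← kroneckerMap_transpose, transpose_one]

theorem liftPow_list_prod (l : List (Matrix (Fin (16 ^ t)) (Fin (16 ^ t)) ℝ)) :
    liftPow t u h l.prod = (l.map (liftPow t u h)).prod := by
  induction l with
  | nil => simp [liftPow_one]
  | cons A l ih => simp [liftPow_mul, ih]

theorem liftPow_apply (i j : Fin (16 ^ u)) :
    liftPow t u h A i j = if i.val / 16 ^ t = j.val / 16 ^ t then
      A ⟨i.val % 16 ^ t, Nat.mod_lt _ (by positivity)⟩ ⟨j.val % 16 ^ t, Nat.mod_lt _ (by positivity)⟩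
      else 0 := by
  simp [liftPow, castM, diagExt]

theorem liftPow_self : liftPow t t le_rfl A = A := by
  ext i j
  simp [liftPow_apply, Nat.div_eq_of_lt, Nat.mod_eq_of_lt]

theorem liftPow_liftPow {v : ℕ} (huv : u ≤ v) :
    liftPow u v huv (liftPow t u h A) = liftPow t v (h.trans huv) A := by
  ext i j
  have hdvd : 16 ^ t ∣ 16 ^ u := pow_dvd_pow 16 h
  obtain ⟨k, hk⟩ := hdvd
  simp only [liftPow_apply, hk, Nat.mod_mul_right_mod, Nat.mod_mul_right_div_self,
    ← Nat.div_div_eq_div_mul, ← ite_and]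
  congr 1
  rw [eq_iff_iff]
  constructor
  · rintro ⟨h₁, h₂⟩
    rw [← Nat.div_add_mod (i.val / 16 ^ t) k, h₁, h₂, Nat.div_add_mod]
  · intro h₁
    rw [h₁]
    exact ⟨rfl, rfl⟩

end liftPow

section topBlock

variable (t : ℕ) (J K : Matrix (Fin 16) (Fin 16) ℝ)

theorem topBlock_mul : topBlock t (J * K) = topBlock t J * topBlock t K := by
  simp only [topBlock, castM_blockExt, reindex_apply]
  rw [submatrix_mul_equiv, ← mul_kronecker_mul, one_mul]

theorem topBlock_add : topBlock t (J + K) = topBlock t J + topBlock t K := by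
  simp only [topBlock, castM_blockExt, add_kronecker]
  rfl

theorem topBlock_zero : topBlock t 0 = 0 := by
  simp [topBlock, castM_blockExt]

theorem topBlock_one : topBlock t 1 = 1 := by
  rw [topBlock, castM_blockExt, one_kronecker_one, reindex_apply, submatrix_one_equiv]

theorem topBlock_neg : topBlock t (-J) = -topBlock t J := by
  rw [eq_neg_iff_add_eq_zero, ← topBlock_add, neg_add_cancel, topBlock_zero]

theorem topBlock_transpose : (topBlock t J)ᵀ = topBlock t Jᵀ := by
  simp only [topBlock, castM_blockExt, transpose_reindex, ← kroneckerMap_transpose, transpose_one]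

theorem liftPow_commute_topBlock (A : Matrix (Fin (16 ^ t)) (Fin (16 ^ t)) ℝ) :
    Commute (liftPow t (t + 1) t.le_succ A) (topBlock t J) := by
  have hlift : liftPow t (t + 1) t.le_succ A =
      castM (pow_succ 16 t).symm (diagExt (16 ^ t) 16 A) := by
    ext i j
    simp [liftPow_apply, castM, diagExt]
  rw [hlift, topBlock, castM_diagExt, castM_blockExt, commute_iff_eq, reindex_apply,
    reindex_apply, submatrix_mul_equiv, submatrix_mul_equiv, ← mul_kronecker_mul,
    ← mul_kronecker_mul, one_mul, mul_one, one_mul, mul_one]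

theorem Cmat_pow_succ : Cmat (16 ^ (t + 1)) = topBlock t (Cmat 16) := by
  ext i j
  have hpos : 0 < 16 ^ t := by positivity
  have hlt : 2 * i.val < 16 ^ (t + 1) ↔ 2 * (i.val / 16 ^ t) < 16 := by
    have : i.val / 16 ^ t < 8 ↔ i.val < 8 * 16 ^ t := Nat.div_lt_iff_lt_mul hpos
    have hsucc : 16 ^ (t + 1) = 16 ^ t * 16 := pow_succ 16 t
    omega
  have hij : i = j ↔ i.val % 16 ^ t = j.val % 16 ^ t ∧ i.val / 16 ^ t = j.val / 16 ^ t := by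
    rw [Fin.ext_iff]
    refine ⟨fun h => by simp [h], fun ⟨h₁, h₂⟩ => ?_⟩
    rw [← Nat.div_add_mod i.val (16 ^ t), h₁, h₂, Nat.div_add_mod]
  simp only [Cmat, topBlock, castM, blockExt, diagonal_apply, reindex_apply, submatrix_apply,
    of_apply, dif_pos hpos, finCongr_symm, finCongr_apply, Fin.val_cast, Fin.mk.injEq, hlt, hij,
    ite_and]

end topBlock

/-! ### The Jordan–Wigner recursion -/

/-- The product of the conjugations of levels `1,…,t` on `ℝ^(16^t)`. -/
noncomputable def signMat (t : ℕ) : Matrix (Fin (16 ^ t)) (Fin (16 ^ t)) ℝ :=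
  Tmat t * Cmat (16 ^ t)

theorem Tmat_succ (t : ℕ) : Tmat (t + 1) = liftPow t (t + 1) t.le_succ (signMat t) := by
  have hK (s : ℕ) (hs : s ≤ t) :
      Kmat (t + 1) s (hs.trans t.le_succ) = liftPow t (t + 1) t.le_succ (Kmat t s hs) :=
    (liftPow_liftPow hs _ t.le_succ).symm
  rw [signMat, liftPow_mul, Tmat, Tmat, liftPow_list_prod, List.finRange_succ_last]
  simp only [List.map_append, List.map_map, List.map_cons, List.map_nil, List.prod_append,
    List.prod_singleton]
  congr 1
  congr 1
  exact List.map_congr_left fun s _ => hK s.val s.isLt.le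

/-- The top-level operator `T_(t+1) · block(J)` on `ℝ^(16^(t+1))`. -/
noncomputable def topField (t : ℕ) (J : Matrix (Fin 16) (Fin 16) ℝ) :
    Matrix (Fin (16 ^ (t + 1))) (Fin (16 ^ (t + 1))) ℝ :=
  liftPow t (t + 1) t.le_succ (signMat t) * topBlock t J

theorem signMat_zero : signMat 0 = 1 := by
  ext i j
  simp [signMat, Tmat, Cmat, Matrix.one_apply]

theorem signMat_succ (t : ℕ) : signMat (t + 1) = topField t (Cmat 16) := by
  rw [signMat, Tmat_succ, Cmat_pow_succ, topField]

theorem Bq_succ (q t : ℕ) (ht : 1 ≤ t + 1) (htq : t + 1 ≤ q) (J : Matrix (Fin 16) (Fin 16) ℝ) :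
    Bq q (t + 1) ht htq J = liftPow (t + 1) q htq (topField t J) := by
  rw [topField, ← Tmat_succ]
  rfl

theorem Cmat_mul_self (N : ℕ) : Cmat N * Cmat N = 1 := by
  rw [Cmat, diagonal_mul_diagonal, ← diagonal_one]
  congr 1
  ext i
  split_ifs <;> norm_num

theorem topField_mul_of_signMat {t : ℕ} (ht : signMat t * signMat t = 1)
    (J K : Matrix (Fin 16) (Fin 16) ℝ) : topField t J * topField t K = topBlock t (J * K) := by
  rw [topField, topField, mul_assoc, ← mul_assoc (topBlock t J),
    ← (liftPow_commute_topBlock t J (signMat t)).eq, mul_assoc, ← mul_assoc, ← liftPow_mul, ht,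
    liftPow_one, one_mul, topBlock_mul]

theorem signMat_mul_self (t : ℕ) : signMat t * signMat t = 1 := by
  induction t with
  | zero => rw [signMat_zero, one_mul]
  | succ t ih =>
    rw [signMat_succ, topField_mul_of_signMat ih, Cmat_mul_self, topBlock_one]

theorem topField_mul (t : ℕ) (J K : Matrix (Fin 16) (Fin 16) ℝ) :
    topField t J * topField t K = topBlock t (J * K) :=
  topField_mul_of_signMat (signMat_mul_self t) J K

theorem topField_transpose_of_signMat {t : ℕ} (ht : (signMat t)ᵀ = signMat t)
    (J : Matrix (Fin 16) (Fin 16) ℝ) : (topField t J)ᵀ = topField t Jᵀ := by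
  rw [topField, transpose_mul, liftPow_transpose, topBlock_transpose, ht,
    ← (liftPow_commute_topBlock t _ _).eq, topField]

theorem signMat_transpose (t : ℕ) : (signMat t)ᵀ = signMat t := by
  induction t with
  | zero => rw [signMat_zero, transpose_one]
  | succ t ih =>
    rw [signMat_succ, topField_transpose_of_signMat ih, Cmat, diagonal_transpose]

theorem topField_transpose (t : ℕ) (J : Matrix (Fin 16) (Fin 16) ℝ) :
    (topField t J)ᵀ = topField t Jᵀ :=
  topField_transpose_of_signMat (signMat_transpose t) J

/-- An operator anticommuting with the sign operator of level `u` anticommutes, after extension,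
with every top-level operator of level `u + 1`. -/
theorem liftPow_mul_topField_add {u : ℕ} {A : Matrix (Fin (16 ^ u)) (Fin (16 ^ u)) ℝ}
    (hA : A * signMat u + signMat u * A = 0) (K : Matrix (Fin 16) (Fin 16) ℝ) :
    liftPow u (u + 1) u.le_succ A * topField u K +
      topField u K * liftPow u (u + 1) u.le_succ A = 0 := by
  rw [topField, mul_assoc _ (topBlock u K), ← (liftPow_commute_topBlock u K A).eq, ← mul_assoc,
    ← mul_assoc, ← add_mul, ← liftPow_mul, ← liftPow_mul, ← liftPow_add, hA, liftPow_zero,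
    zero_mul]

theorem liftPow_topField_mul_signMat_add {t u : ℕ} (h : t + 1 ≤ u)
    {J : Matrix (Fin 16) (Fin 16) ℝ} (hJ : J * Cmat 16 + Cmat 16 * J = 0) :
    liftPow (t + 1) u h (topField t J) * signMat u +
      signMat u * liftPow (t + 1) u h (topField t J) = 0 := by
  induction u, h using Nat.le_induction with
  | base =>
    rw [liftPow_self, signMat_succ, topField_mul, topField_mul, ← topBlock_add, hJ, topBlock_zero]
  | succ u h ih =>
    rw [signMat_succ, ← liftPow_liftPow h _ u.le_succ]
    exact liftPow_mul_topField_add ih _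

/-! ### The vector field matrices -/

theorem Bq_J16_transpose (q t : ℕ) (ht : 1 ≤ t) (htq : t ≤ q) (α : Fin 8) :
    (Bq q t ht htq (J16 α))ᵀ = -Bq q t ht htq (J16 α) := by
  obtain ⟨t, rfl⟩ := Nat.exists_eq_add_of_le' ht
  rw [Bq_succ, liftPow_transpose, topField_transpose, J16_transpose, ← liftPow_neg, topField,
    topBlock_neg, mul_neg, topField]

theorem Bq_J16_mul_self (q t : ℕ) (ht : 1 ≤ t) (htq : t ≤ q) (α : Fin 8) :
    Bq q t ht htq (J16 α) * Bq q t ht htq (J16 α) = -1 := by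
  obtain ⟨t, rfl⟩ := Nat.exists_eq_add_of_le' ht
  rw [Bq_succ, ← liftPow_mul, topField_mul, J16_mul_self, topBlock_neg, topBlock_one, liftPow_neg,
    liftPow_one]

theorem Bq_J16_anticomm_of_lt {q t t' : ℕ} (ht : 1 ≤ t) (htq : t ≤ q) (ht' : 1 ≤ t')
    (ht'q : t' ≤ q) (h : t < t') (α β : Fin 8) :
    Bq q t ht htq (J16 α) * Bq q t' ht' ht'q (J16 β) +
      Bq q t' ht' ht'q (J16 β) * Bq q t ht htq (J16 α) = 0 := by
  obtain ⟨t, rfl⟩ := Nat.exists_eq_add_of_le' ht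
  obtain ⟨u, rfl⟩ := Nat.exists_eq_add_of_le' ht'
  have htu : t + 1 ≤ u := Nat.le_of_lt_succ h
  rw [Bq_succ, Bq_succ, ← liftPow_liftPow (htu.trans u.le_succ) _ ht'q,
    ← liftPow_liftPow htu _ u.le_succ, ← liftPow_mul, ← liftPow_mul, ← liftPow_add,
    liftPow_mul_topField_add (liftPow_topField_mul_signMat_add htu (J16_mul_Cmat_add α)),
    liftPow_zero]

theorem Bq_J16_anticomm {q t t' : ℕ} (ht : 1 ≤ t) (htq : t ≤ q) (ht' : 1 ≤ t')
    (ht'q : t' ≤ q) {α β : Fin 8} (h : (t, α) ≠ (t', β)) :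
    Bq q t ht htq (J16 α) * Bq q t' ht' ht'q (J16 β) +
      Bq q t' ht' ht'q (J16 β) * Bq q t ht htq (J16 α) = 0 := by
  rcases lt_trichotomy t t' with hlt | rfl | hlt
  · exact Bq_J16_anticomm_of_lt ht htq ht' ht'q hlt α β
  · have hαβ : α ≠ β := fun e => h (by rw [e])
    obtain ⟨t, rfl⟩ := Nat.exists_eq_add_of_le' ht
    rw [Bq_succ, Bq_succ, ← liftPow_mul, ← liftPow_mul, ← liftPow_add, topField_mul, topField_mul,
      ← topBlock_add, J16_mul_add_mul, if_neg hαβ, zero_smul, topBlock_zero, liftPow_zero]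
  · rw [add_comm]
    exact Bq_J16_anticomm_of_lt ht' ht'q ht htq hlt β α

/-- Skew-symmetric matrices move the transposition inside a dot product at the cost of a sign. -/
theorem mulVec_dotProduct_of_transpose_eq_neg {n : Type*} [Fintype n] {A : Matrix n n ℝ}
    (hA : Aᵀ = -A) (x y : n → ℝ) : A *ᵥ x ⬝ᵥ y = -(x ⬝ᵥ A *ᵥ y) := by
  rw [dotProduct_comm, dotProduct_mulVec, ← mulVec_transpose, hA, neg_mulVec, neg_dotProduct,
    dotProduct_comm]

theorem mulVec_dotProduct_self_of_transpose_eq_neg {n : Type*} [Fintype n] {A : Matrix n n ℝ}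
    (hA : Aᵀ = -A) (x : n → ℝ) : A *ᵥ x ⬝ᵥ x = 0 := by
  have h := mulVec_dotProduct_of_transpose_eq_neg hA x x
  rw [dotProduct_comm x] at h
  linarith

theorem mulVec_dotProduct_mulVec_of_anticomm {n : Type*} [Fintype n] {A B : Matrix n n ℝ}
    (hA : Aᵀ = -A) (hB : Bᵀ = -B) (hAB : A * B + B * A = 0) (x : n → ℝ) :
    A *ᵥ x ⬝ᵥ B *ᵥ x = 0 := by
  have h₁ := mulVec_dotProduct_of_transpose_eq_neg hA x (B *ᵥ x)
  have h₂ := mulVec_dotProduct_of_transpose_eq_neg hB x (A *ᵥ x)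
  have h₃ : x ⬝ᵥ A *ᵥ B *ᵥ x + x ⬝ᵥ B *ᵥ A *ᵥ x = 0 := by
    rw [mulVec_mulVec, mulVec_mulVec, ← dotProduct_add, ← add_mulVec, hAB, zero_mulVec,
      dotProduct_zero]
  rw [dotProduct_comm (B *ᵥ x)] at h₂
  linarith

/-- The `8q` matrices `B^q(t,J_α)` (`1 ≤ t ≤ q`, `α = 1,…,8`)
are skew-symmetric, square to `-Id`, and pairwise anticommute; hence they give
`8q` orthonormal tangent vector fields at every point of `S^(16^q - 1)`. -/
theorem Bq_orthonormal_fields (q t t' : ℕ) (ht : 1 ≤ t) (htq : t ≤ q)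
    (ht' : 1 ≤ t') (ht'q : t' ≤ q) (α β : Fin 8) :
    (Bq q t ht htq (J16 α))ᵀ = -Bq q t ht htq (J16 α) ∧
    Bq q t ht htq (J16 α) * Bq q t ht htq (J16 α) = -1 ∧
    ((t, α) ≠ (t', β) →
      Bq q t ht htq (J16 α) * Bq q t' ht' ht'q (J16 β) +
        Bq q t' ht' ht'q (J16 β) * Bq q t ht htq (J16 α) = 0) ∧
    (∀ x : Fin (16 ^ q) → ℝ, x ⬝ᵥ x = 1 →
      (Bq q t ht htq (J16 α)).mulVec x ⬝ᵥ x = 0 ∧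
      (Bq q t ht htq (J16 α)).mulVec x ⬝ᵥ (Bq q t' ht' ht'q (J16 β)).mulVec x =
        if (t, α) = (t', β) then 1 else 0) := by
  have hA := Bq_J16_transpose q t ht htq α
  refine ⟨hA, Bq_J16_mul_self q t ht htq α, Bq_J16_anticomm ht htq ht' ht'q, fun x hx =>
    ⟨mulVec_dotProduct_self_of_transpose_eq_neg hA x, ?_⟩⟩
  split_ifs with h
  · obtain ⟨rfl, rfl⟩ := Prod.mk.inj h
    rw [mulVec_dotProduct_of_transpose_eq_neg hA, mulVec_mulVec, Bq_J16_mul_self, neg_mulVec,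
      one_mulVec, dotProduct_neg, neg_neg, hx]
  · exact mulVec_dotProduct_mulVec_of_anticomm hA (Bq_J16_transpose q t' ht' ht'q β)
      (Bq_J16_anticomm ht htq ht' ht'q h) x
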